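/- arXiv:0908.3411 — 2 statements merged into one kernel-verified Lean document; each statement's English description precedes it below -/
import Mathlib

section
/- Let ρ ≥ 1 and let B be a ρ-regular bipartite graph whose two vertex classes both have size n. Then the number μ(B) of perfect matchings of B satisfies μ(B) ≥ (ρ/n)ⁿ · n!. -/
open scoped Classical

/-- Degree of a vertex of the first class of a bipartite graph `E ⊆ U × W`. -/
noncomputable def degL {U W : Type*} (E : Finset (U × W)) (a : U) : ℕ :=
  (E.filter fun e => e.1 = a).card

/-- Degree of a vertex of the second class of a bipartite graph `E ⊆ U × W`. -/
noncomputable def degR {U W : Type*} (E : Finset (U × W)) (b : W) : ℕ :=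
  (E.filter fun e => e.2 = b).card

namespace PermanentBound

open MvPolynomial

lemma multiset_prod_le_mean_pow (s : Multiset ℝ) (hs : ∀ a ∈ s, 0 ≤ a) :
    s.prod ≤ (s.sum / s.card) ^ s.card := by
  rcases Multiset.empty_or_exists_mem s with rfl | ⟨b, hb⟩
  · simp
  have hcard : 0 < s.card := Multiset.card_pos_iff_exists_mem.2 ⟨b, hb⟩
  have hk : (0 : ℝ) < s.card := by exact_mod_cast hcard
  have h := Real.geom_mean_le_arith_mean (Finset.univ : Finset s) (fun _ => 1) (fun x => x.1)
    (by simp) (by simpa using hk) (fun x _ => hs _ (Multiset.coe_mem))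
  have hprod : ∏ x : s, x.1 = s.prod := by
    rw [Finset.prod_eq_multiset_prod, Multiset.map_univ_coe]
  have hsum : ∑ x : s, x.1 = s.sum := by
    rw [Finset.sum_eq_multiset_sum, Multiset.map_univ_coe]
  simp only [Real.rpow_one, one_mul, Finset.sum_const, Finset.card_univ, Multiset.card_coe,
    nsmul_eq_mul, mul_one, hprod, hsum] at h
  have h0 : 0 ≤ s.prod := Multiset.prod_nonneg hs
  calc s.prod = (s.prod ^ ((s.card : ℝ)⁻¹)) ^ s.card := (Real.rpow_inv_natCast_pow h0 hcard.ne').symm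
    _ ≤ _ := pow_le_pow_left₀ (by positivity) h _

/-- A polynomial whose roots are negative reals grows at most like the power of its tangent
at the origin. -/
lemma eval_le_of_roots_neg (f : Polynomial ℂ) (hk : f.natDegree ≠ 0)
    (hroots : ∀ r ∈ f.roots, ∃ a : ℝ, 0 < a ∧ r = -(a : ℂ))
    {f₀ q t y : ℝ} (hf₀ : 0 < f₀) (h₀ : f.eval 0 = f₀) (hq : f.derivative.eval 0 = q)
    (ht : 0 ≤ t) (hy : f.eval (t : ℂ) = y) :
    0 ≤ q / f₀ ∧ y ≤ f₀ * (1 + t * (q / f₀) / f.natDegree) ^ f.natDegree := by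
  have hsplit := IsAlgClosed.splits f
  have hcard : f.natDegree = f.roots.card := hsplit.natDegree_eq_card_roots
  obtain ⟨s, hs⟩ : ∃ s : Multiset ℝ, f.roots = s.map (fun a : ℝ => -(a : ℂ)) ∧ ∀ a ∈ s, 0 < a := by
    refine ⟨f.roots.map (fun r => -r.re), ?_, ?_⟩
    · rw [Multiset.map_map]
      conv_lhs => rw [← Multiset.map_id f.roots]
      refine Multiset.map_congr rfl fun r hr => ?_
      obtain ⟨a, -, rfl⟩ := hroots r hr
      simp
    · intro a ha
      obtain ⟨r, hr, rfl⟩ := Multiset.mem_map.1 ha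
      obtain ⟨a, ha, h⟩ := hroots r hr
      simpa [h] using ha
  obtain ⟨hs, hpos⟩ := hs
  have hcs : f.natDegree = s.card := by rw [hcard, hs, Multiset.card_map]
  have hf0 : f.eval 0 ≠ 0 := by rw [h₀]; exact_mod_cast hf₀.ne'
  have hsum : q / f₀ = (s.map (fun a => a⁻¹)).sum := by
    have h := hsplit.eval_derivative_div_eval_of_ne_zero hf0
    rw [h₀, hq, hs, Multiset.map_map] at h
    have : ((q / f₀ : ℝ) : ℂ) = (((s.map (fun a => a⁻¹)).sum : ℝ) : ℂ) := by
      rw [← Complex.ofRealHom_eq_coe ((s.map (fun a => a⁻¹)).sum), map_multiset_sum, Multiset.map_map]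
      push_cast
      rw [h]
      simp
    exact_mod_cast this
  have hprod : y = f₀ * (s.map (fun a => 1 + t * a⁻¹)).prod := by
    have h1 := hsplit.eval_eq_prod_roots (t : ℂ)
    have h2 := hsplit.eval_eq_prod_roots 0
    rw [hs, Multiset.map_map] at h1 h2
    have : (y : ℂ) = ((f₀ * (s.map (fun a => 1 + t * a⁻¹)).prod : ℝ) : ℂ) := by
      rw [Complex.ofReal_mul, ← h₀, ← hy, h1, h2, mul_assoc,
        ← Complex.ofRealHom_eq_coe (Multiset.prod _), map_multiset_prod, Multiset.map_map,
        ← Multiset.prod_map_mul]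
      congr 2
      refine Multiset.map_congr rfl fun a ha => ?_
      have : (a : ℂ) ≠ 0 := by exact_mod_cast (hpos a ha).ne'
      simp
      field_simp
      ring
    exact_mod_cast this
  have hinv : ∀ b ∈ s.map (fun a => a⁻¹), 0 ≤ b := by
    intro b hb
    obtain ⟨a, ha, rfl⟩ := Multiset.mem_map.1 hb
    exact (inv_pos.2 (hpos a ha)).le
  refine ⟨hsum ▸ Multiset.sum_nonneg hinv, ?_⟩
  rw [hprod]
  refine mul_le_mul_of_nonneg_left ?_ hf₀.le
  have h := multiset_prod_le_mean_pow (s.map (fun a => 1 + t * a⁻¹)) (by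
    intro b hb
    obtain ⟨a, ha, rfl⟩ := Multiset.mem_map.1 hb
    have := hpos a ha
    positivity)
  rw [Multiset.sum_map_add, Multiset.sum_map_mul_left, Multiset.card_map, ← hsum, ← hcs] at h
  have hn : (f.natDegree : ℝ) ≠ 0 := by exact_mod_cast hk
  rw [Multiset.map_const', Multiset.sum_replicate, ← hcs, nsmul_eq_mul, mul_one, add_div,
    div_self hn] at h
  exact h

lemma mul_le_of_forall_mul_le {k : ℕ} {C f₀ s : ℝ} (hC : 0 < C) (hf₀ : 0 < f₀) (hs : 0 ≤ s)
    (h : ∀ t : ℝ, 0 < t → C * t ≤ f₀ * (1 + t * s / (k + 1 : ℕ)) ^ (k + 1)) :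
    C * ((k : ℝ) / (k + 1)) ^ k ≤ f₀ * s := by
  rcases Nat.eq_zero_or_pos k with rfl | hk
  · simp only [pow_zero, mul_one]
    by_contra! hlt
    have hd : 0 < C - f₀ * s := by linarith
    have := h (2 * f₀ / (C - f₀ * s)) (by positivity)
    simp only [zero_add, Nat.cast_one, div_one, pow_one] at this
    have h2 : (C - f₀ * s) * (2 * f₀ / (C - f₀ * s)) = 2 * f₀ := by field_simp
    nlinarith
  · have hk' : (0 : ℝ) < k := by exact_mod_cast hk
    rcases hs.eq_or_lt with rfl | hs
    · exfalso
      have := h (2 * f₀ / C) (by positivity)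
      simp only [mul_zero, zero_div, add_zero, one_pow, mul_one] at this
      have h2 : C * (2 * f₀ / C) = 2 * f₀ := by field_simp
      linarith
    · have h1 := h ((k + 1) / (s * k)) (by positivity)
      have h2 : 1 + ((k : ℝ) + 1) / (s * k) * s / (k + 1 : ℕ) = (k + 1) / k := by
        push_cast; field_simp
      rw [h2, pow_succ] at h1
      have h3 : C ≤ f₀ * s * (((k : ℝ) + 1) / k) ^ k := by
        have h4 : C * (((k : ℝ) + 1) / (s * k)) = C / s * ((k + 1) / k) := by field_simp
        rw [h4, ← mul_assoc] at h1
        have h5 := le_of_mul_le_mul_right h1 (by positivity)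
        rw [div_le_iff₀ hs] at h5
        linarith
      calc C * ((k : ℝ) / (k + 1)) ^ k
          ≤ f₀ * s * (((k : ℝ) + 1) / k) ^ k * ((k : ℝ) / (k + 1)) ^ k := by gcongr
        _ = f₀ * s := by
          rw [mul_assoc, ← mul_pow]
          have : ((k : ℝ) + 1) / k * (k / (k + 1)) = 1 := by field_simp
          rw [this, one_pow, mul_one]

variable {σ : Type*}

/-- Homogeneous real polynomials of degree `k` with positive coefficients and no zeros in the
open right half-space. -/
structure PosStable (k : ℕ) (P : MvPolynomial σ ℝ) : Prop where
  homog : P.IsHomogeneous k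
  coeff_pos : ∀ m : σ →₀ ℕ, m.degree = k → 0 < P.coeff m
  stable : ∀ z : σ → ℂ, (∀ i, 0 < (z i).re) → aeval z P ≠ 0

/-- The restriction of `P` to the line through `z` in the direction of the `j`-th basis vector. -/
noncomputable def lineRestrict (z : σ → ℂ) (j : σ) (P : MvPolynomial σ ℝ) : Polynomial ℂ :=
  aeval (fun i => Polynomial.C (z i) + Pi.single (M := fun _ => Polynomial ℂ) j Polynomial.X i) P

lemma eval_lineRestrict (z : σ → ℂ) (j : σ) (P : MvPolynomial σ ℝ) (t : ℂ) :
    (lineRestrict z j P).eval t = aeval (fun i => z i + Pi.single (M := fun _ => ℂ) j t i) P := by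
  have h := MvPolynomial.comp_aeval_apply
    (fun i => Polynomial.C (z i) + Pi.single (M := fun _ => Polynomial ℂ) j Polynomial.X i)
    ((Polynomial.aeval (R := ℂ) t).restrictScalars ℝ) P
  rw [lineRestrict]
  simp only [AlgHom.restrictScalars_apply, Polynomial.coe_aeval_eq_eval] at h
  rw [h]
  congr 2
  funext i
  by_cases hi : i = j
  · subst hi; simp
  · simp [hi]

lemma derivative_lineRestrict (z : σ → ℂ) (j : σ) (P : MvPolynomial σ ℝ) :
    (lineRestrict z j P).derivative = lineRestrict z j (pderiv j P) := by
  induction P using MvPolynomial.induction_on with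
  | C a =>
    simp only [lineRestrict, pderiv_C, map_zero, algHom_C]
    rw [IsScalarTower.algebraMap_apply ℝ ℂ (Polynomial ℂ), ← Polynomial.C_eq_algebraMap,
      Polynomial.derivative_C]
  | add p q hp hq => simp only [lineRestrict, map_add] at *; rw [hp, hq]
  | mul_X p i hp =>
    simp only [lineRestrict, pderiv_mul, map_mul, map_add, Polynomial.derivative_mul, aeval_X,
      pderiv_X] at *
    rw [hp]
    by_cases hi : i = j
    · subst hi; simp
    · simp [hi]

lemma degree_lineRestrict {P : MvPolynomial σ ℝ} {k : ℕ} (hh : P.IsHomogeneous k)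
    (hc : ∀ m : σ →₀ ℕ, m.degree = k → 0 < P.coeff m) (z : σ → ℂ) (j : σ) :
    (lineRestrict z j P).degree = k := by
  induction k generalizing P with
  | zero =>
    have h0 := hc 0 (by simp)
    have hP : P = C (P.coeff 0) := totalDegree_eq_zero_iff_eq_C.1 (by
      have := hh.totalDegree_le; omega)
    rw [hP, lineRestrict, algHom_C, IsScalarTower.algebraMap_apply ℝ ℂ (Polynomial ℂ),
      ← Polynomial.C_eq_algebraMap, Polynomial.degree_C]
    · rfl
    · simpa using h0.ne'
  | succ k ih =>
    have hd := ih (P := pderiv j P) (by simpa using hh.pderiv) (fun m hm => by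
      rw [coeff_pderiv]
      have := hc (m + Finsupp.single j 1) (by simp [hm])
      positivity)
    rw [← derivative_lineRestrict] at hd
    have hn : (lineRestrict z j P).natDegree ≠ 0 := by
      intro h
      rw [Polynomial.derivative_of_natDegree_zero h] at hd
      simp at hd
    have h1 := Polynomial.natDegree_eq_of_degree_eq_some hd
    rw [Polynomial.natDegree_derivative] at h1
    rw [Polynomial.degree_eq_iff_natDegree_eq_of_pos (by omega)]
    omega

lemma PosStable.pderiv {P : MvPolynomial σ ℝ} {k : ℕ} (hP : PosStable (k + 1) P) (j : σ) :
    PosStable k (pderiv j P) where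
  homog := by simpa using hP.homog.pderiv
  coeff_pos m hm := by
    rw [coeff_pderiv]
    have := hP.coeff_pos (m + Finsupp.single j 1) (by simp [hm])
    positivity
  stable z hz := by
    set f := lineRestrict z j P with hf
    have hdeg : f.degree = (k + 1 : ℕ) := degree_lineRestrict hP.homog hP.coeff_pos z j
    have heval : f.derivative.eval 0 = aeval z (MvPolynomial.pderiv j P) := by
      rw [hf, derivative_lineRestrict, eval_lineRestrict]; simp
    have hsplit := IsAlgClosed.splits f
    have hroots : ∀ r ∈ f.roots, 0 < (1 / (0 - r)).re := by
      intro r hr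
      have h0 := (Polynomial.mem_roots'.1 hr).2
      rw [Polynomial.IsRoot.def, hf, eval_lineRestrict] at h0
      have hneg : r.re < 0 := by
        by_contra! hre
        refine hP.stable _ (fun i => ?_) h0
        have := hz i
        by_cases hi : i = j
        · subst hi; simp; linarith
        · simpa [hi] using this
      have hr0 : r ≠ 0 := by rintro rfl; simp at hneg
      rw [zero_sub, one_div, Complex.inv_re, Complex.neg_re, Complex.normSq_neg]
      exact div_pos (by linarith) (Complex.normSq_pos.2 hr0)
    have hf0 : f.eval 0 ≠ 0 := by
      rw [hf, eval_lineRestrict]; simpa using hP.stable z hz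
    rw [← heval, hsplit.eval_derivative_eq_eval_mul_sum hf0]
    refine mul_ne_zero hf0 fun hsum => ?_
    have hcard : f.roots.card = k + 1 := by
      rw [← hsplit.natDegree_eq_card_roots]; exact Polynomial.natDegree_eq_of_degree_eq_some hdeg
    have h2 : 0 < ((f.roots.map fun r => 1 / (0 - r)).map Complex.re).sum := by
      obtain ⟨r, hr⟩ := Multiset.card_pos_iff_exists_mem.1 (by rw [hcard]; exact k.succ_pos : 0 < f.roots.card)
      obtain ⟨s, hs⟩ := Multiset.exists_cons_of_mem hr
      rw [hs] at hroots ⊢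
      rw [Multiset.map_cons, Multiset.map_cons, Multiset.sum_cons]
      refine add_pos_of_pos_of_nonneg (hroots r (Multiset.mem_cons_self r s))
        (Multiset.sum_nonneg fun y hy => ?_)
      simp only [Multiset.map_map, Multiset.mem_map, Function.comp] at hy
      obtain ⟨w, hw, rfl⟩ := hy
      exact (hroots w (Multiset.mem_cons_of_mem hw)).le
    have h3 := map_multiset_sum Complex.reAddGroupHom (f.roots.map fun r => 1 / (0 - r))
    rw [hsum] at h3
    simp only [Complex.coe_reAddGroupHom, Complex.zero_re] at h3
    linarith

lemma exists_re_pos_mul_re_pos {r : ℂ} (hr : 0 < r.re ∨ r.im ≠ 0) :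
    ∃ u : ℂ, 0 < u.re ∧ 0 < (u * r).re := by
  by_cases him : r.im = 0
  · exact ⟨1, by simp, by simpa [him] using hr⟩
  · refine ⟨⟨1, -((1 - r.re) / r.im)⟩, by simp, ?_⟩
    simp [him]

lemma aeval_mul_of_isHomogeneous {P : MvPolynomial σ ℝ} {k : ℕ} (hP : P.IsHomogeneous k)
    (u : ℂ) (z : σ → ℂ) : aeval (fun i => u * z i) P = u ^ k * aeval z P := by
  rw [aeval_def, aeval_def, eval₂_eq, eval₂_eq, Finset.mul_sum]
  refine Finset.sum_congr rfl fun m hm => ?_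
  have hd : m.degree = k := by
    by_contra h
    exact (mem_support_iff.1 hm) (hP.coeff_eq_zero h)
  simp only [mul_pow, Finset.prod_mul_distrib, Finset.prod_pow_eq_pow_sum]
  rw [← Finsupp.degree_apply, hd]
  ring

lemma PosStable.roots_neg {P : MvPolynomial σ ℝ} {k : ℕ} (hP : PosStable k P) {x : σ → ℝ}
    (hx : ∀ i, 0 < x i) (j : σ) {r : ℂ}
    (hr : (lineRestrict (fun i => (x i : ℂ)) j P).eval r = 0) :
    ∃ a : ℝ, 0 < a ∧ r = -(a : ℂ) := by
  rw [eval_lineRestrict] at hr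
  have key : ¬ (0 < r.re ∨ r.im ≠ 0) := by
    intro h
    obtain ⟨u, hu, hur⟩ := exists_re_pos_mul_re_pos h
    refine hP.stable (fun i => u * ((x i : ℂ) + Pi.single (M := fun _ => ℂ) j r i)) (fun i => ?_) ?_
    · have h1 : 0 < (u * (x i : ℂ)).re := by simpa using mul_pos hu (hx i)
      by_cases hi : i = j
      · subst hi
        simp only [Pi.single_eq_same, mul_add, Complex.add_re]
        linarith
      · simpa [hi] using h1
    · rw [aeval_mul_of_isHomogeneous hP.homog, hr, mul_zero]
  push Not at key
  have h0 : r.re ≠ 0 := by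
    intro h
    have hr0 : r = 0 := Complex.ext h key.2
    subst hr0
    exact hP.stable (fun i => (x i : ℂ)) (by simpa using hx) (by simpa using hr)
  refine ⟨-r.re, by have := lt_of_le_of_ne key.1 h0; linarith, ?_⟩
  apply Complex.ext <;> simp [key.2]

lemma aeval_ofReal (P : MvPolynomial σ ℝ) (x : σ → ℝ) :
    aeval (fun i => (x i : ℂ)) P = ((eval x P : ℝ) : ℂ) := by
  have := aeval_algebraMap_apply (B := ℂ) x P
  simpa [aeval_eq_eval, Function.comp_def] using this

lemma PosStable.eval_add_single_le {P : MvPolynomial σ ℝ} {k : ℕ} (hP : PosStable (k + 1) P)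
    {x : σ → ℝ} (hx : ∀ i, 0 < x i) (hPx : 0 < eval x P) (j : σ) {t : ℝ} (ht : 0 ≤ t) :
    0 ≤ eval x (MvPolynomial.pderiv j P) / eval x P ∧
    eval (fun i => x i + Pi.single (M := fun _ => ℝ) j t i) P ≤
      eval x P * (1 + t * (eval x (MvPolynomial.pderiv j P) / eval x P) / (k + 1 : ℕ)) ^ (k + 1) := by
  have hd := Polynomial.natDegree_eq_of_degree_eq_some
    (degree_lineRestrict hP.homog hP.coeff_pos (fun i => (x i : ℂ)) j)
  have h := eval_le_of_roots_neg (lineRestrict (fun i => (x i : ℂ)) j P) (by rw [hd]; omega)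
    (fun r hr => hP.roots_neg hx j (Polynomial.mem_roots'.1 hr).2) (f₀ := eval x P)
    (q := eval x (MvPolynomial.pderiv j P)) (t := t)
    (y := eval (fun i => x i + Pi.single (M := fun _ => ℝ) j t i) P) hPx
    (by rw [eval_lineRestrict, ← aeval_ofReal]; simp)
    (by rw [derivative_lineRestrict, eval_lineRestrict, ← aeval_ofReal]; simp) ht
    (by
      rw [eval_lineRestrict, ← aeval_ofReal]
      congr 2
      funext i
      by_cases hi : i = j
      · subst hi; simp
      · simp [hi])
  rwa [hd] at h

/-- Gurvits' capacity inequality for the multilinear coefficient supported on `T`. -/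
theorem PosStable.capacity_le_coeff {k : ℕ} {P : MvPolynomial σ ℝ} (hP : PosStable k P)
    (T : Finset σ) (hT : T.card = k) {c : ℝ} (hc : 0 < c)
    (hcap : ∀ x : σ → ℝ, (∀ i, 0 < x i) → c * ∏ i ∈ T, x i ≤ eval x P) :
    c * (k.factorial / (k : ℝ) ^ k) ≤ P.coeff (∑ i ∈ T, Finsupp.single i 1) := by
  induction k generalizing P T c with
  | zero =>
    have hP0 : P = C (P.coeff 0) := totalDegree_eq_zero_iff_eq_C.1 (by
      have := hP.homog.totalDegree_le; omega)
    obtain rfl := Finset.card_eq_zero.1 hT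
    have h := hcap (fun _ => 1) (by simp)
    rw [hP0] at h
    simpa using h
  | succ k ih =>
    obtain ⟨j, hj⟩ : T.Nonempty := Finset.card_pos.1 (by omega)
    have h := ih (hP.pderiv j) (T.erase j) (by rw [Finset.card_erase_of_mem hj]; omega)
      (c := c * ((k : ℝ) / (k + 1)) ^ k) (by
        rcases Nat.eq_zero_or_pos k with rfl | hk
        · simpa using hc
        · positivity) (fun x hx => by
        have hX : 0 < ∏ i ∈ T.erase j, x i := Finset.prod_pos fun i _ => hx i
        have hPx : 0 < eval x P :=
          (mul_pos hc (Finset.prod_pos fun i _ => hx i)).trans_le (hcap x hx)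
        have hg := mul_le_of_forall_mul_le (k := k) (mul_pos hc hX) hPx
          (hP.eval_add_single_le hx hPx j le_rfl).1 (fun t ht => by
            refine le_trans ?_ (hP.eval_add_single_le hx hPx j ht.le).2
            refine le_trans ?_ (hcap _ fun i => ?_)
            · rw [← Finset.mul_prod_erase T _ hj, mul_assoc, mul_comm _ t]
              have h1 : ∏ i ∈ T.erase j, (x i + Pi.single (M := fun _ => ℝ) j t i) =
                  ∏ i ∈ T.erase j, x i :=
                Finset.prod_congr rfl fun i hi => by simp [Finset.ne_of_mem_erase hi]
              rw [h1]
              have := hx j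
              simp only [Pi.single_eq_same]
              gcongr
              linarith
            · have := hx i
              by_cases hi : i = j
              · subst hi; simp; linarith
              · simpa [hi] using this)
        rw [mul_div_cancel₀ _ hPx.ne'] at hg
        calc _ = (c * ∏ i ∈ T.erase j, x i) * ((k : ℝ) / (k + 1)) ^ k := by ring
          _ ≤ _ := by linarith)
    rw [coeff_pderiv, Finset.sum_erase_add T _ hj] at h
    have h0 : (∑ i ∈ T.erase j, Finsupp.single i 1 : σ →₀ ℕ) j = 0 := by
      rw [Finsupp.finsetSum_apply]
      exact Finset.sum_eq_zero fun i hi => by simp [Finset.ne_of_mem_erase hi]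
    rw [h0, Nat.cast_zero, zero_add, mul_one] at h
    refine le_trans (le_of_eq ?_) h
    rcases Nat.eq_zero_or_pos k with rfl | hk
    · simp
    · rw [Nat.factorial_succ]
      push_cast
      rw [div_pow, pow_succ]
      field_simp

section LinearForms

variable {ι : Type*} [Fintype σ]

lemma coeff_prod_linear_pos {b : ι → σ → ℝ} (hb : ∀ i j, 0 < b i j) (s : Finset ι)
    (m : σ →₀ ℕ) (hm : m.degree = s.card) :
    0 < coeff m (∏ i ∈ s, ∑ j, C (b i j) * X j) := by
  induction s using Finset.induction_on generalizing m with
  | empty =>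
    obtain rfl := (Finsupp.degree_eq_zero_iff m).1 (by simpa using hm)
    simp
  | insert a s ha ih =>
    rw [Finset.card_insert_of_notMem ha] at hm
    have hsub : ∀ j ∈ m.support, (m - Finsupp.single j 1).degree = s.card := by
      intro j hj
      have hle : Finsupp.single j 1 ≤ m := by
        rw [Finsupp.single_le_iff]
        exact Nat.one_le_iff_ne_zero.2 (Finsupp.mem_support_iff.1 hj)
      have := congrArg Finsupp.degree (tsub_add_cancel_of_le hle)
      rw [map_add, Finsupp.degree_single] at this
      omega
    have hterm : ∀ j, coeff m (C (b a j) * X j * ∏ i ∈ s, ∑ j, C (b i j) * X j) =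
        b a j * if j ∈ m.support then
          coeff (m - Finsupp.single j 1) (∏ i ∈ s, ∑ j, C (b i j) * X j) else 0 := by
      intro j
      rw [mul_assoc, coeff_C_mul, coeff_X_mul']
    rw [Finset.prod_insert ha, Finset.sum_mul, coeff_sum, Finset.sum_congr rfl fun j _ => hterm j]
    obtain ⟨j, hj⟩ : m.support.Nonempty := by
      rw [Finsupp.support_nonempty_iff]
      rintro rfl
      simp at hm
    refine Finset.sum_pos' (fun i _ => ?_) ⟨j, Finset.mem_univ j, ?_⟩
    · refine mul_nonneg (hb a i).le ?_
      split_ifs with h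
      · exact (ih _ (hsub i h)).le
      · exact le_rfl
    · rw [if_pos hj]
      exact mul_pos (hb a j) (ih _ (hsub j hj))

variable [Fintype ι]

lemma posStable_prod_linear [Nonempty σ] {b : ι → σ → ℝ} (hb : ∀ i j, 0 < b i j) :
    PosStable (Fintype.card ι) (∏ i, ∑ j, C (b i j) * X j) where
  homog := by
    have h := IsHomogeneous.prod Finset.univ (fun i => ∑ j, C (b i j) * X j) (fun _ => 1)
      fun i _ => IsHomogeneous.sum _ _ _ fun j _ => isHomogeneous_C_mul_X (b i j) j
    simpa using h
  coeff_pos m hm := coeff_prod_linear_pos hb _ m hm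
  stable z hz := by
    rw [map_prod]
    refine Finset.prod_ne_zero_iff.2 fun i _ h => ?_
    have h1 : 0 < ∑ j, b i j * (z j).re :=
      Finset.sum_pos (fun j _ => mul_pos (hb i j) (hz j)) Finset.univ_nonempty
    have h2 := congrArg Complex.re h
    simp at h2
    linarith

lemma coeff_prod_linear (hcard : Fintype.card ι = Fintype.card σ) (b : ι → σ → ℝ) :
    coeff (∑ j, Finsupp.single j 1) (∏ i, ∑ j, C (b i j) * X j) =
      ∑ f : ι ≃ σ, ∏ i, b i (f i) := by
  have hterm : ∀ g : ι → σ, coeff (∑ j, Finsupp.single j 1) (∏ i, C (b i (g i)) * X (g i)) =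
      if Function.Bijective g then ∏ i, b i (g i) else 0 := by
    intro g
    have h1 : ∏ i, C (b i (g i)) * X (g i) =
        monomial (∑ i, Finsupp.single (g i) 1) (∏ i, b i (g i)) := by
      rw [monomial_sum_index, Finset.prod_mul_distrib, map_prod]
      rfl
    have h2 : (∑ i, Finsupp.single (g i) 1 : σ →₀ ℕ) = ∑ j, Finsupp.single j 1 ↔
        Function.Bijective g := by
      constructor
      · intro h
        refine (Fintype.bijective_iff_surjective_and_card g).2 ⟨fun j => ?_, hcard⟩
        by_contra! hj
        have := DFunLike.congr_fun h j
        simp [Finsupp.finsetSum_apply, Finsupp.single_apply, hj] at this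
      · intro h
        exact h.sum_comp fun j => Finsupp.single j 1
    rw [h1, coeff_monomial]
    simp only [h2]
  rw [Finset.prod_univ_sum, Fintype.piFinset_univ, coeff_sum,
    Finset.sum_congr rfl fun g _ => hterm g, ← Finset.sum_filter]
  symm
  refine Finset.sum_bij (fun f _ => f) (fun f _ => ?_) (fun f _ g _ h => ?_) (fun g hg => ?_)
    fun f _ => rfl
  · simp
  · exact DFunLike.coe_injective h
  · exact ⟨Equiv.ofBijective g (Finset.mem_filter.1 hg).2, Finset.mem_univ _, rfl⟩

lemma mul_prod_le_prod_linear {b : ι → σ → ℝ} (hb : ∀ i j, 0 < b i j) {r : ℝ} (hr : 0 < r)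
    (hrow : ∀ i, ∑ j, b i j = r) (hcol : ∀ j, ∑ i, b i j = r) {x : σ → ℝ} (hx : ∀ j, 0 < x j) :
    r ^ Fintype.card ι * ∏ j, x j ≤ ∏ i, ∑ j, b i j * x j := by
  have hrowle : ∀ i, r * ∏ j, x j ^ (b i j / r) ≤ ∑ j, b i j * x j := by
    intro i
    have h := Real.geom_mean_le_arith_mean_weighted Finset.univ (fun j => b i j / r) x
      (fun j _ => (div_pos (hb i j) hr).le) (by rw [← Finset.sum_div, hrow, div_self hr.ne'])
      (fun j _ => (hx j).le)
    calc r * ∏ j, x j ^ (b i j / r) ≤ r * ∑ j, b i j / r * x j := by gcongr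
      _ = ∑ j, b i j * x j := by
        rw [Finset.mul_sum]
        refine Finset.sum_congr rfl fun j _ => ?_
        field_simp
  calc r ^ Fintype.card ι * ∏ j, x j = ∏ i, r * ∏ j, x j ^ (b i j / r) := by
        rw [Finset.prod_mul_distrib, Finset.prod_const, Finset.card_univ, Finset.prod_comm]
        congr 1
        refine Finset.prod_congr rfl fun j _ => ?_
        rw [← Real.rpow_sum_of_pos (hx j), ← Finset.sum_div, hcol, div_self hr.ne', Real.rpow_one]
    _ ≤ _ := Finset.prod_le_prod
        (fun i _ => mul_nonneg hr.le (Finset.prod_nonneg fun j _ => Real.rpow_nonneg (hx j).le _))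
        fun i _ => hrowle i

/-- Van der Waerden's inequality for positive matrices with constant line sums. -/
theorem van_der_waerden_of_pos [Nonempty σ] (hcard : Fintype.card ι = Fintype.card σ)
    {b : ι → σ → ℝ} (hb : ∀ i j, 0 < b i j) {r : ℝ} (hr : 0 < r)
    (hrow : ∀ i, ∑ j, b i j = r) (hcol : ∀ j, ∑ i, b i j = r) :
    r ^ Fintype.card ι * ((Fintype.card ι).factorial / (Fintype.card ι : ℝ) ^ Fintype.card ι) ≤
      ∑ f : ι ≃ σ, ∏ i, b i (f i) := by
  rw [← coeff_prod_linear hcard]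
  refine (posStable_prod_linear hb).capacity_le_coeff Finset.univ
    (by rw [Finset.card_univ, hcard]) (by positivity) fun x hx => ?_
  simpa using mul_prod_le_prod_linear hb hr hrow hcol hx

/-- Van der Waerden's inequality for nonnegative matrices with constant line sums. -/
theorem van_der_waerden_of_nonneg [Nonempty σ] (hcard : Fintype.card ι = Fintype.card σ)
    {b : ι → σ → ℝ} (hb : ∀ i j, 0 ≤ b i j) {r : ℝ} (hr : 0 ≤ r)
    (hrow : ∀ i, ∑ j, b i j = r) (hcol : ∀ j, ∑ i, b i j = r) :
    r ^ Fintype.card ι * ((Fintype.card ι).factorial / (Fintype.card ι : ℝ) ^ Fintype.card ι) ≤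
      ∑ f : ι ≃ σ, ∏ i, b i (f i) := by
  have hn : (0 : ℝ) < Fintype.card σ := by exact_mod_cast Fintype.card_pos
  have hL : Continuous fun ε : ℝ => (r + Fintype.card σ * ε) ^ Fintype.card ι *
      ((Fintype.card ι).factorial / (Fintype.card ι : ℝ) ^ Fintype.card ι) := by fun_prop
  have hR : Continuous fun ε : ℝ => ∑ f : ι ≃ σ, ∏ i, (b i (f i) + ε) := by fun_prop
  have h := le_of_tendsto_of_tendsto (b := nhdsWithin (0 : ℝ) (Set.Ioi 0))
    ((hL.tendsto 0).mono_left nhdsWithin_le_nhds) ((hR.tendsto 0).mono_left nhdsWithin_le_nhds)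
    (by
      filter_upwards [self_mem_nhdsWithin] with ε hε
      have hε : 0 < ε := hε
      refine van_der_waerden_of_pos hcard (b := fun i j => b i j + ε)
        (fun i j => add_pos_of_nonneg_of_pos (hb i j) hε) (by positivity) (fun i => ?_) fun j => ?_
      · simp [Finset.sum_add_distrib, hrow]
      · simp [Finset.sum_add_distrib, hcol, hcard])
  simpa using h

end LinearForms

end PermanentBound

/-- Egorychev–Falikman, Van der Waerden conjecture: a `ρ`-regular bipartite
graph with classes of size `n` has at least `(ρ/n)ⁿ · n!` perfect matchings. -/
theorem van_der_waerden_lower_bound_on_perfect_matchings :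
    ∀ n ρ : ℕ, 1 ≤ ρ →
    ∀ (U W : Type) [Fintype U] [Fintype W] [DecidableEq U] [DecidableEq W],
      Fintype.card U = n → Fintype.card W = n →
    ∀ E : Finset (U × W),
      (∀ u : U, degL E u = ρ) → (∀ w : W, degR E w = ρ) →
      ((ρ : ℝ) / (n : ℝ))^n * (Nat.factorial n : ℝ) ≤
        ((Nat.card {f : U ≃ W // ∀ u, (u, f u) ∈ E}) : ℝ) := by
  intro n ρ _ U W _ _ _ _ hU hW E hL hR
  rcases Nat.eq_zero_or_pos n with rfl | hn
  · have := Fintype.card_eq_zero_iff.1 hU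
    have := Fintype.card_eq_zero_iff.1 hW
    have hpos : 0 < Nat.card {f : U ≃ W // ∀ u, (u, f u) ∈ E} :=
      Nat.card_pos_iff.2 ⟨⟨⟨Equiv.equivOfIsEmpty U W, fun u => isEmptyElim u⟩⟩, inferInstance⟩
    have h : (1 : ℝ) ≤ Nat.card {f : U ≃ W // ∀ u, (u, f u) ∈ E} := by exact_mod_cast hpos
    simpa using h
  · have : Nonempty W := Fintype.card_pos_iff.1 (hW ▸ hn)
    have hrow : ∀ u : U, ∑ w : W, (if (u, w) ∈ E then (1 : ℝ) else 0) = ρ := by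
      intro u
      rw [Finset.sum_boole, ← hL u, degL]
      congr 1
      refine Finset.card_bij (fun w _ => (u, w)) ?_ ?_ ?_ <;> aesop
    have hcol : ∀ w : W, ∑ u : U, (if (u, w) ∈ E then (1 : ℝ) else 0) = ρ := by
      intro w
      rw [Finset.sum_boole, ← hR w, degR]
      congr 1
      refine Finset.card_bij (fun u _ => (u, w)) ?_ ?_ ?_ <;> aesop
    have h := PermanentBound.van_der_waerden_of_nonneg (hU.trans hW.symm)
      (b := fun u w => if (u, w) ∈ E then (1 : ℝ) else 0)
      (fun u w => by split_ifs <;> norm_num) (Nat.cast_nonneg ρ) hrow hcol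
    rw [hU] at h
    rw [Nat.card_eq_fintype_card, Fintype.card_subtype, div_pow, div_mul_eq_mul_div]
    rw [← mul_div_assoc] at h
    refine h.trans (le_of_eq ?_)
    simp only [Finset.prod_boole, Finset.mem_univ, true_imp_iff, Finset.sum_boole]
    congr!
end

section
/- For every θ ∈ (0,1] there exists n₀ = n₀(θ) such that the following holds. Let B be a θn-regular bipartite graph with vertex classes U and W, |U| = |W| = n ≥ n₀, and let M₁ be a perfect matching between U and W that is edge-disjoint from B. Then the number of perfect matchings M₂ of B for which the 2-factor F = M₁ ∪ M₂ contains more than n/(log n)^{1/5} cycles is at most e^{−n} times the total number of perfect matchings of B. Equivalently, if M₂ is chosen uniformly at random among all perfect matchings of B, then the probability that M₁ ∪ M₂ contains more than n/(log n)^{1/5} cycles is at most e^{−n}. -/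
open scoped Classical

/-- For columns `J` and rows `I`, the sum over all injective assignments of rows to the columns
of `J` of the product of the entries used, times the weights `y` of the rows left unused. -/
noncomputable def partialPermanent {ι κ : Type*} (a : ι → κ → ℝ) (y : ι → ℝ) :
    List κ → Finset ι → ℝ
  | [], I => ∏ i ∈ I, y i
  | j :: J, I => ∑ i ∈ I, a i j * partialPermanent a y J (I.erase i)

section PartialPermanent

variable {ι κ : Type*} {a : ι → κ → ℝ}

lemma Finset.sum_list_map_sum_comm (I : Finset ι) (L : List κ) (f : ι → κ → ℝ) :
    ∑ i ∈ I, (L.map (f i)).sum = (L.map fun j => ∑ i ∈ I, f i j).sum := by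
  induction L with
  | nil => simp
  | cons j L ih => simp [Finset.sum_add_distrib, ih]

lemma partialPermanent_nonneg (ha : ∀ i j, 0 ≤ a i j) {y : ι → ℝ} (hy : ∀ i, 0 ≤ y i)
    (J : List κ) (I : Finset ι) : 0 ≤ partialPermanent a y J I := by
  induction J generalizing I with
  | nil => exact Finset.prod_nonneg fun i _ => hy i
  | cons j J ih => exact Finset.sum_nonneg fun i _ => mul_nonneg (ha i j) (ih _)

lemma partialPermanent_perm (a : ι → κ → ℝ) (y : ι → ℝ) {J J' : List κ} (h : J.Perm J')
    (I : Finset ι) : partialPermanent a y J I = partialPermanent a y J' I := by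
  induction h generalizing I with
  | nil => rfl
  | cons j _ ih => simp only [partialPermanent, ih]
  | swap j k J =>
    simp only [partialPermanent, Finset.mul_sum]
    rw [Finset.sum_comm' (t' := I) (s' := fun i => I.erase i)]
    · refine Finset.sum_congr rfl fun i _ => Finset.sum_congr rfl fun l _ => ?_
      rw [Finset.erase_right_comm]; ring
    · intro x z; simp only [Finset.mem_erase]; tauto
  | trans _ _ ih₁ ih₂ => rw [ih₁, ih₂]

/-- Expansion along a row. -/
lemma partialPermanent_insert (a : ι → κ → ℝ) (y : ι → ℝ) (J : List κ) {i : ι} {I : Finset ι}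
    (hi : i ∉ I) :
    partialPermanent a y J (insert i I) = y i * partialPermanent a y J I +
      (J.map fun j => a i j * partialPermanent a y (J.erase j) I).sum := by
  induction J generalizing I with
  | nil => simp [partialPermanent, Finset.prod_insert hi]
  | cons j J ih =>
    have key : ∀ l ∈ J, partialPermanent a y ((j :: J).erase l) I =
        partialPermanent a y (j :: J.erase l) I := by
      intro l hl
      by_cases h : j = l
      · subst h
        rw [List.erase_cons_head]
        exact partialPermanent_perm a y (List.perm_cons_erase hl) I
      · rw [List.erase_cons_tail (by simpa using h)]
    have hmap : (J.map fun l => a i l * partialPermanent a y ((j :: J).erase l) I) =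
        J.map fun l => a i l * partialPermanent a y (j :: J.erase l) I :=
      List.map_congr_left fun l hl => by rw [key l hl]
    rw [List.map_cons, List.sum_cons, hmap, List.erase_cons_head]
    simp only [partialPermanent]
    rw [Finset.sum_insert hi, Finset.erase_insert hi]
    have hrow : ∀ k ∈ I, a k j * partialPermanent a y J ((insert i I).erase k) =
        y i * (a k j * partialPermanent a y J (I.erase k)) +
        (J.map fun l => a i l * (a k j * partialPermanent a y (J.erase l) (I.erase k))).sum := by
      intro k hk
      have hne : i ≠ k := fun h => hi (h ▸ hk)
      rw [Finset.erase_insert_of_ne hne, ih (fun h => hi (Finset.mem_of_mem_erase h)), mul_add,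
        ← List.sum_map_mul_left]
      congr 1
      · ring
      · congr 1
        exact List.map_congr_left fun l _ => by ring
    rw [Finset.sum_congr rfl hrow, Finset.sum_add_distrib, ← Finset.mul_sum]
    have hcomm : ∑ k ∈ I,
        (J.map fun l => a i l * (a k j * partialPermanent a y (J.erase l) (I.erase k))).sum =
        (J.map fun l =>
          a i l * ∑ k ∈ I, a k j * partialPermanent a y (J.erase l) (I.erase k)).sum := by
      simp only [Finset.mul_sum]
      exact Finset.sum_list_map_sum_comm I J _
    rw [hcomm]
    ring

lemma partialPermanent_erase_mul_le (ha : ∀ i j, 0 ≤ a i j) {y z : ι → ℝ} (hy : ∀ i, 0 ≤ y i)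
    (hyz : ∀ i, y i ≤ z i) (J : List κ) (I : Finset ι) {i : ι} (hi : i ∈ I) :
    partialPermanent a z J (I.erase i) * partialPermanent a y J I ≤
      partialPermanent a y J (I.erase i) * partialPermanent a z J I := by
  induction hn : J.length using Nat.strong_induction_on generalizing J I i with
  | _ n ih =>
    have hz : ∀ i, 0 ≤ z i := fun i => (hy i).trans (hyz i)
    have h1 := partialPermanent_insert a y J (Finset.notMem_erase i I)
    have h2 := partialPermanent_insert a z J (Finset.notMem_erase i I)
    rw [Finset.insert_erase hi] at h1 h2
    rw [h1, h2, mul_add, mul_add, ← List.sum_map_mul_left, ← List.sum_map_mul_left]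
    refine add_le_add ?_ (List.sum_le_sum fun j hj => ?_)
    · have := mul_le_mul_of_nonneg_right (hyz i) (mul_nonneg
        (partialPermanent_nonneg ha hy J (I.erase i))
        (partialPermanent_nonneg ha hz J (I.erase i)))
      linarith
    · have hlen : (J.erase j).length < n := by
        rw [List.length_erase_of_mem hj]
        have := List.length_pos_of_mem hj
        omega
      rw [partialPermanent_perm a y (List.perm_cons_erase hj),
        partialPermanent_perm a z (List.perm_cons_erase hj)]
      simp only [partialPermanent, Finset.sum_mul]
      refine Finset.sum_le_sum fun k hk => ?_
      have := mul_le_mul_of_nonneg_left (ih _ hlen (J.erase j) (I.erase i) hk rfl)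
        (mul_nonneg (ha k j) (ha i j))
      linarith

lemma partialPermanent_cons_mul_le (ha : ∀ i j, 0 ≤ a i j) {y z : ι → ℝ} (hy : ∀ i, 0 ≤ y i)
    (hyz : ∀ i, y i ≤ z i) (j : κ) (J : List κ) (I : Finset ι) :
    partialPermanent a z (j :: J) I * partialPermanent a y J I ≤
      partialPermanent a y (j :: J) I * partialPermanent a z J I := by
  simp only [partialPermanent, Finset.sum_mul]
  refine Finset.sum_le_sum fun k hk => ?_
  have := mul_le_mul_of_nonneg_left (partialPermanent_erase_mul_le ha hy hyz J I hk) (ha k j)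
  linarith

lemma partialPermanent_sub_le (ha : ∀ i j, 0 ≤ a i j) {y z : ι → ℝ} (hy : ∀ i, 0 ≤ y i)
    (hyz : ∀ i, y i ≤ z i) (J : List κ) (I : Finset ι) :
    partialPermanent a z J I - partialPermanent a y J I ≤
      ∑ k ∈ I, (z k - y k) * partialPermanent a z J (I.erase k) := by
  have hz : ∀ i, 0 ≤ z i := fun i => (hy i).trans (hyz i)
  induction J generalizing I with
  | nil =>
    simp only [partialPermanent]
    induction I using Finset.induction_on with
    | empty => simp
    | insert i I hi ih =>
      rw [Finset.prod_insert hi, Finset.prod_insert hi, Finset.sum_insert hi,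
        Finset.erase_insert hi]
      have hs : ∑ k ∈ I, (z k - y k) * ∏ l ∈ (insert i I).erase k, z l =
          z i * ∑ k ∈ I, (z k - y k) * ∏ l ∈ I.erase k, z l := by
        rw [Finset.mul_sum]
        refine Finset.sum_congr rfl fun k hk => ?_
        have hne : i ≠ k := fun h => hi (h ▸ hk)
        rw [Finset.erase_insert_of_ne hne,
          Finset.prod_insert (fun h => hi (Finset.mem_of_mem_erase h))]
        ring
      rw [hs]
      have hle : ∏ l ∈ I, y l ≤ ∏ l ∈ I, z l :=
        Finset.prod_le_prod (fun l _ => hy l) fun l _ => hyz l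
      nlinarith [mul_le_mul_of_nonneg_left ih (hz i),
        mul_le_mul_of_nonneg_left hle (sub_nonneg.2 (hyz i))]
  | cons j J ih =>
    simp only [partialPermanent]
    calc _ = ∑ i ∈ I, a i j *
          (partialPermanent a z J (I.erase i) - partialPermanent a y J (I.erase i)) := by
          rw [← Finset.sum_sub_distrib]
          exact Finset.sum_congr rfl fun i _ => by ring
      _ ≤ ∑ i ∈ I, a i j * ∑ k ∈ I.erase i,
          (z k - y k) * partialPermanent a z J ((I.erase i).erase k) :=
          Finset.sum_le_sum fun i _ => mul_le_mul_of_nonneg_left (ih _) (ha i j)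
      _ = _ := by
          simp only [Finset.mul_sum]
          rw [Finset.sum_comm' (t' := I) (s' := fun i => I.erase i)]
          · refine Finset.sum_congr rfl fun i _ => Finset.sum_congr rfl fun l _ => ?_
            rw [Finset.erase_right_comm]; ring
          · intro x z; simp only [Finset.mem_erase]; tauto

lemma continuous_partialPermanent (a : ι → κ → ℝ) (J : List κ) (I : Finset ι) :
    Continuous fun y => partialPermanent a y J I := by
  induction J generalizing I with
  | nil => simp only [partialPermanent]; fun_prop
  | cons j J ih => simp only [partialPermanent]; fun_prop

/-- Absorbing one more column loses at most a factor `4` in capacity. -/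
lemma le_four_mul_partialPermanent_cons (ha : ∀ i j, 0 ≤ a i j) {y : ι → ℝ} (hy : ∀ i, 0 ≤ y i)
    (j : κ) (J : List κ) (I : Finset ι) {K : ℝ}
    (hK : ∀ t : ℝ, 0 < t → K * t ≤ partialPermanent a (fun i => y i + t * a i j) J I) :
    K ≤ 4 * partialPermanent a y (j :: J) I := by
  set R : ℝ → ℝ := fun t => partialPermanent a (fun i => y i + t * a i j) J I with hR
  set D : ℝ → ℝ := fun t => partialPermanent a (fun i => y i + t * a i j) (j :: J) I with hD
  set r := partialPermanent a y J I with hr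
  set c := partialPermanent a y (j :: J) I with hc
  have hr0 : 0 ≤ r := partialPermanent_nonneg ha hy _ _
  have hc0 : 0 ≤ c := partialPermanent_nonneg ha hy _ _
  have hle : ∀ t : ℝ, 0 < t → ∀ i, y i ≤ y i + t * a i j := fun t ht i =>
    le_add_of_nonneg_right (mul_nonneg ht.le (ha i j))
  have hratio : ∀ t : ℝ, 0 < t → D t * r ≤ c * R t := fun t ht =>
    partialPermanent_cons_mul_le ha hy (hle t ht) j J I
  have hconv : ∀ t : ℝ, 0 < t → R t - r ≤ t * D t := by
    intro t ht
    refine (partialPermanent_sub_le ha hy (hle t ht) J I).trans_eq ?_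
    simp only [hD, partialPermanent, Finset.mul_sum]
    exact Finset.sum_congr rfl fun i _ => by ring
  rcases hr0.eq_or_lt with h0 | hrpos
  · have hD' : ∀ t : ℝ, 0 < t → K ≤ D t := by
      intro t ht
      have h1 := hK t ht
      have h2 := hconv t ht
      exact le_of_mul_le_mul_right (by linarith : K * t ≤ D t * t) ht
    have hcont : Continuous D :=
      (continuous_partialPermanent a (j :: J) I).comp (by fun_prop)
    have hlim : Filter.Tendsto D (nhdsWithin 0 (Set.Ioi 0)) (nhds c) := by
      have := (hcont.tendsto 0).mono_left (nhdsWithin_le_nhds (s := Set.Ioi 0))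
      simpa [hD, hc] using this
    have : K ≤ c := ge_of_tendsto hlim (eventually_nhdsWithin_of_forall hD')
    linarith
  · have hbound : ∀ t : ℝ, 0 < t → (R t - r) * r ≤ t * (c * R t) := fun t ht =>
      calc (R t - r) * r ≤ t * D t * r := mul_le_mul_of_nonneg_right (hconv t ht) hr0
        _ = t * (D t * r) := by ring
        _ ≤ _ := mul_le_mul_of_nonneg_left (hratio t ht) ht.le
    rcases hc0.eq_or_lt with h0 | hcpos
    · by_contra! hlt
      have hKpos : 0 < K := by linarith
      have ht : 0 < 2 * r / K := by positivity
      have h1 := hbound _ ht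
      have h2 := hK _ ht
      rw [mul_div_cancel₀ _ hKpos.ne'] at h2
      rw [← h0] at h1
      nlinarith
    · have ht : 0 < r / (2 * c) := by positivity
      have h1 := hbound _ ht
      have h2 := hK _ ht
      have h3 : r / (2 * c) * (c * R (r / (2 * c))) = r * R (r / (2 * c)) / 2 := by
        field_simp
      rw [h3] at h1
      have h4 : R (r / (2 * c)) ≤ 2 * r := by nlinarith
      have h5 : K * (r / (2 * c)) ≤ 4 * c * (r / (2 * c)) := by
        have : 4 * c * (r / (2 * c)) = 2 * r := by field_simp; ring
        linarith
      exact le_of_mul_le_mul_right h5 ht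

variable [Fintype ι] [Fintype κ]

lemma pow_mul_prod_le_prod_sum {d : ℝ} (hd : 0 < d) (ha : ∀ i j, 0 ≤ a i j)
    (hrow : ∀ i, ∑ j, a i j = d) (hcol : ∀ j, ∑ i, a i j = d) {x : κ → ℝ} (hx : ∀ j, 0 < x j) :
    d ^ Fintype.card ι * ∏ j, x j ≤ ∏ i, ∑ j, x j * a i j := by
  have hi : ∀ i, d * ∏ j, x j ^ (a i j / d) ≤ ∑ j, x j * a i j := by
    intro i
    have := Real.geom_mean_le_arith_mean_weighted Finset.univ (fun j => a i j / d) x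
      (fun j _ => div_nonneg (ha i j) hd.le)
      (by rw [← Finset.sum_div, hrow, div_self hd.ne']) (fun j _ => (hx j).le)
    calc d * ∏ j, x j ^ (a i j / d) ≤ d * ∑ j, a i j / d * x j :=
          mul_le_mul_of_nonneg_left this hd.le
      _ = _ := by
          rw [Finset.mul_sum]
          exact Finset.sum_congr rfl fun j _ => by field_simp
  refine le_trans (le_of_eq ?_) (Finset.prod_le_prod (fun i _ => ?_) fun i _ => hi i)
  · rw [Finset.prod_mul_distrib, Finset.prod_const, Finset.card_univ, Finset.prod_comm]
    congr 1
    refine Finset.prod_congr rfl fun j _ => ?_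
    rw [← Real.rpow_sum_of_pos (hx j), ← Finset.sum_div, hcol, div_self hd.ne', Real.rpow_one]
  · exact mul_nonneg hd.le (Finset.prod_nonneg fun j _ => Real.rpow_nonneg (hx j).le _)

lemma pow_mul_prod_le_partialPermanent {d : ℝ} (hd : 0 < d) (ha : ∀ i j, 0 ≤ a i j)
    (hrow : ∀ i, ∑ j, a i j = d) (hcol : ∀ j, ∑ i, a i j = d) (J : List κ) (hJ : J.Nodup)
    {x : κ → ℝ} (hx : ∀ j, 0 < x j) :
    d ^ Fintype.card ι * ∏ j ∈ J.toFinsetᶜ, x j ≤ 4 ^ J.length *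
      partialPermanent a (fun i => ∑ j ∈ J.toFinsetᶜ, x j * a i j) J Finset.univ := by
  induction J generalizing x with
  | nil => simpa [partialPermanent] using pow_mul_prod_le_prod_sum hd ha hrow hcol hx
  | cons j J ih =>
    obtain ⟨hj, hJ⟩ := List.nodup_cons.1 hJ
    have hset : J.toFinsetᶜ = insert j (j :: J).toFinsetᶜ := by
      ext l
      by_cases h : l = j
      · simp [h, hj]
      · simp [h]
    have hjn : j ∉ (j :: J).toFinsetᶜ := by simp
    have h4 : (0 : ℝ) < 4 ^ J.length := by positivity
    have hy : ∀ i, 0 ≤ ∑ l ∈ (j :: J).toFinsetᶜ, x l * a i l := fun i =>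
      Finset.sum_nonneg fun l _ => mul_nonneg (hx l).le (ha i l)
    have := le_four_mul_partialPermanent_cons ha hy j J Finset.univ
      (K := d ^ Fintype.card ι * (∏ l ∈ (j :: J).toFinsetᶜ, x l) / 4 ^ J.length) ?_
    · rw [div_le_iff₀ h4] at this
      rw [List.length_cons, pow_succ]
      linarith
    · intro t ht
      have hx' : ∀ l, 0 < Function.update x j t l := by
        intro l
        by_cases h : l = j
        · subst h; simpa using ht
        · simpa [h] using hx l
      have h := ih hJ hx'
      have hupd : ∀ l ∈ (j :: J).toFinsetᶜ, Function.update x j t l = x l := fun l hl =>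
        by
        have hne : l ≠ j := fun h => hjn (h ▸ hl)
        exact Function.update_of_ne hne _ _
      rw [hset, Finset.prod_insert hjn, Finset.prod_congr rfl hupd] at h
      simp only [Finset.sum_insert hjn, Function.update_self] at h
      have hsum : (fun i => t * a i j +
          ∑ l ∈ (j :: J).toFinsetᶜ, Function.update x j t l * a i l) =
          fun i => ∑ l ∈ (j :: J).toFinsetᶜ, x l * a i l + t * a i j := by
        funext i
        rw [add_comm, Finset.sum_congr rfl fun l hl => by rw [hupd l hl]]
      rw [hsum] at h
      rw [div_mul_eq_mul_div, div_le_iff₀ h4]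
      linarith

lemma partialPermanent_zero_le_card (B : Finset (ι × κ)) (c : ι) (J : List κ) (hJ : J.Nodup)
    (I : Finset ι) :
    partialPermanent (fun i j => if (i, j) ∈ B then 1 else 0) (fun _ => 0) J I ≤
      ((Finset.univ.filter fun f : κ → ι => (∀ j ∈ J, f j ∈ I ∧ (f j, j) ∈ B) ∧
        Set.InjOn f {j | j ∈ J} ∧ ∀ j ∉ J, f j = c).card : ℝ) := by
  induction J generalizing I with
  | nil =>
    rcases I.eq_empty_or_nonempty with rfl | ⟨i, hi⟩
    · simp only [partialPermanent, Finset.prod_empty]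
      exact_mod_cast Finset.card_pos.2 ⟨fun _ => c, by simp⟩
    · rw [partialPermanent, Finset.prod_eq_zero hi rfl]
      positivity
  | cons j J ih =>
    obtain ⟨hj, hJ⟩ := List.nodup_cons.1 hJ
    set S : List κ → Finset ι → Finset (κ → ι) := fun J I =>
      Finset.univ.filter fun f : κ → ι => (∀ j ∈ J, f j ∈ I ∧ (f j, j) ∈ B) ∧
        Set.InjOn f {j | j ∈ J} ∧ ∀ j ∉ J, f j = c with hS
    have hinj : ∀ i, Set.InjOn (fun f : κ → ι => Function.update f j i) (S J (I.erase i)) := by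
      intro i f hf g hg hfg
      simp only [hS, Finset.coe_filter, Set.mem_ofPred_eq] at hf hg
      funext l
      by_cases h : l = j
      · subst h; rw [hf.2.2.2 l hj, hg.2.2.2 l hj]
      · simpa [h] using congrFun hfg l
    have hdisj : Set.PairwiseDisjoint (I.filter fun i => (i, j) ∈ B : Set ι)
        (fun i => (S J (I.erase i)).image fun f => Function.update f j i) := by
      intro i _ k _ hik
      refine Finset.disjoint_left.2 fun f hf hf' => hik ?_
      obtain ⟨g, _, rfl⟩ := Finset.mem_image.1 hf
      obtain ⟨g', _, h⟩ := Finset.mem_image.1 hf'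
      simpa using (congrFun h j).symm
    have hsub : ((I.filter fun i => (i, j) ∈ B).biUnion fun i =>
        (S J (I.erase i)).image fun f => Function.update f j i) ⊆ S (j :: J) I := by
      intro f hf
      obtain ⟨i, hi, hf⟩ := Finset.mem_biUnion.1 hf
      obtain ⟨g, hg, rfl⟩ := Finset.mem_image.1 hf
      obtain ⟨hiI, hiB⟩ := Finset.mem_filter.1 hi
      obtain ⟨-, h1, h2, h3⟩ := Finset.mem_filter.1 hg
      have hne : ∀ l ∈ J, l ≠ j := fun l hl h => hj (h ▸ hl)
      refine Finset.mem_filter.2 ⟨Finset.mem_univ _, ?_, ?_, ?_⟩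
      · intro l hl
        rcases List.mem_cons.1 hl with rfl | hl
        · simpa using ⟨hiI, hiB⟩
        · rw [Function.update_of_ne (hne l hl)]
          exact ⟨Finset.mem_of_mem_erase (h1 l hl).1, (h1 l hl).2⟩
      · intro l hl m hm hlm
        rw [Set.mem_ofPred_eq] at hl hm
        rcases List.mem_cons.1 hl with rfl | hlJ <;> rcases List.mem_cons.1 hm with rfl | hmJ
        · rfl
        · rw [Function.update_self, Function.update_of_ne (hne m hmJ)] at hlm
          exact absurd hlm.symm (Finset.ne_of_mem_erase (h1 m hmJ).1)
        · rw [Function.update_self, Function.update_of_ne (hne l hlJ)] at hlm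
          exact absurd hlm (Finset.ne_of_mem_erase (h1 l hlJ).1)
        · rw [Function.update_of_ne (hne l hlJ), Function.update_of_ne (hne m hmJ)] at hlm
          exact h2 hlJ hmJ hlm
      · intro l hl
        rw [List.mem_cons, not_or] at hl
        rw [Function.update_of_ne hl.1, h3 l hl.2]
    have hcard := Finset.card_le_card hsub
    rw [Finset.card_biUnion hdisj] at hcard
    simp only [partialPermanent, ite_mul, one_mul, zero_mul]
    rw [← Finset.sum_filter]
    refine le_trans (Finset.sum_le_sum fun i _ => ih hJ (I.erase i)) ?_
    refine le_trans (le_of_eq ?_) (Nat.cast_le.2 hcard)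
    rw [Nat.cast_sum]
    exact Finset.sum_congr rfl fun i _ => by rw [Finset.card_image_of_injOn (hinj i)]

end PartialPermanent

/-- A weak form of the van der Waerden bound for the number of perfect matchings of a regular
bipartite graph. -/
lemma pow_le_card_perfectMatching {U W : Type*} [Fintype U] [Fintype W]
    (hUW : Fintype.card U = Fintype.card W) [Nonempty U] {d : ℝ} (hd : 0 < d)
    (B : Finset (U × W)) (hL : ∀ u, (degL B u : ℝ) = d) (hR : ∀ w, (degR B w : ℝ) = d) :
    (d / 4) ^ Fintype.card U ≤ (Nat.card {g : U ≃ W // ∀ u, (u, g u) ∈ B} : ℝ) := by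
  set a : U → W → ℝ := fun u w => if (u, w) ∈ B then 1 else 0 with ha
  have hrow : ∀ u, ∑ w, a u w = d := by
    intro u
    rw [← hL u, degL, ha, Finset.sum_boole, Nat.cast_inj]
    refine Finset.card_bij (fun w _ => (u, w)) ?_ ?_ ?_ <;> simp +contextual [eq_comm]
  have hcol : ∀ w, ∑ u, a u w = d := by
    intro w
    rw [← hR w, degR, ha, Finset.sum_boole, Nat.cast_inj]
    refine Finset.card_bij (fun u _ => (u, w)) ?_ ?_ ?_ <;> simp +contextual [eq_comm]
  have hnn : ∀ u w, 0 ≤ a u w := by intro u w; simp only [ha]; split_ifs <;> norm_num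
  have hlow := pow_mul_prod_le_partialPermanent hd hnn hrow hcol Finset.univ.toList
    (Finset.nodup_toList _) (x := fun _ => 1) fun _ => one_pos
  have hup := partialPermanent_zero_le_card B (Classical.arbitrary U) Finset.univ.toList
    (Finset.nodup_toList _) Finset.univ
  simp only [Finset.toList_toFinset, Finset.compl_univ, Finset.prod_empty, mul_one,
    Finset.sum_empty, Finset.length_toList, Finset.card_univ] at hlow
  rw [div_pow, div_le_iff₀ (by positivity), mul_comm]
  rw [← hUW] at hlow
  refine hlow.trans (mul_le_mul_of_nonneg_left (hup.trans ?_) (by positivity))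
  rw [Nat.cast_le, Nat.card_eq_fintype_card, Fintype.card_subtype]
  have hbij : ∀ f : W → U, Function.Injective f → Function.Bijective f := fun f hf =>
    (Fintype.bijective_iff_injective_and_card f).2 ⟨hf, hUW.symm⟩
  refine Finset.card_le_card_of_injOn
    (fun f => if hf : Function.Injective f then (Equiv.ofBijective f (hbij f hf)).symm
      else Fintype.equivOfCardEq hUW) ?_ ?_
  · intro f hf
    simp only [Finset.mem_toList, Finset.mem_univ, true_and, Finset.coe_filter, Set.mem_ofPred_eq,
      forall_true_left, not_true, IsEmpty.forall_iff, implies_true, and_true, Set.ofPred_true,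
      Set.injOn_univ] at hf ⊢
    rw [dif_pos hf.2]
    intro u
    have := hf.1 ((Equiv.ofBijective f (hbij f hf.2)).symm u)
    rwa [Equiv.ofBijective_apply_symm_apply f (hbij f hf.2) u] at this
  · intro f hf g hg hfg
    simp only [Finset.mem_toList, Finset.mem_univ, true_and, Finset.coe_filter, Set.mem_ofPred_eq,
      forall_true_left, not_true, IsEmpty.forall_iff, implies_true, and_true, Set.ofPred_true,
      Set.injOn_univ] at hf hg
    simp only [dif_pos hf.2, dif_pos hg.2] at hfg
    have := congrArg Equiv.symm hfg
    exact congrArg (fun e : W ≃ U => (e : W → U)) this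

/-- A permutation is determined by its values off a set meeting each of its cycles at most
once. -/
lemma Equiv.Perm.eq_of_eqOn_compl {α : Type*} [Finite α] {σ τ : Equiv.Perm α} {S : Set α}
    (hσ : ∀ x ∈ S, ∀ y ∈ S, σ.SameCycle x y → x = y)
    (hτ : ∀ x ∈ S, ∀ y ∈ S, τ.SameCycle x y → x = y)
    (h : ∀ x ∉ S, σ x = τ x) : σ = τ := by
  ext s
  by_cases hs : s ∈ S
  swap
  · exact h s hs
  set s' := τ.symm (σ s) with hs'
  have hτs' : τ s' = σ s := τ.apply_symm_apply _
  have hs'S : s' ∈ S := by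
    by_contra hn
    have h1 := h s' hn
    rw [hτs'] at h1
    exact hn (σ.injective h1 ▸ hs)
  have hex : ∃ m, 0 < m ∧ (σ ^ m) s ∈ S :=
    ⟨orderOf σ, orderOf_pos σ, by rw [pow_orderOf_eq_one]; exact hs⟩
  obtain ⟨hm0, hmS⟩ := Nat.find_spec hex
  have hmin : ∀ i, 0 < i → i < Nat.find hex → (σ ^ i) s ∉ S := fun i h0 hi hS =>
    Nat.find_min hex hi ⟨h0, hS⟩
  set m := Nat.find hex
  have hret : s = (σ ^ m) s := hσ s hs _ hmS ⟨m, by simp⟩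
  have hagree : ∀ i, i + 1 ≤ m → (σ ^ (i + 1)) s = (τ ^ (i + 1)) s' := by
    intro i
    induction i with
    | zero => intro _; simpa using hτs'.symm
    | succ i ih =>
      intro hi
      rw [pow_succ' σ, pow_succ' τ, Equiv.Perm.mul_apply, Equiv.Perm.mul_apply, ← ih (by omega)]
      exact h _ (hmin _ (by omega) (by omega))
  have hlast := hagree (m - 1) (by omega)
  rw [Nat.sub_add_cancel hm0, ← hret] at hlast
  have : s' = s := hτ s' hs'S s hs ⟨m, by simpa using hlast.symm⟩
  rw [← hτs', this]

lemma Equiv.Perm.exists_transversal {α : Type*} [Fintype α] [DecidableEq α]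
    (σ : Equiv.Perm α) :
    ∃ S : Finset α, S.card = σ.cycleType.card ∧ ∀ x ∈ S, ∀ y ∈ S, σ.SameCycle x y → x = y := by
  have hne : ∀ c : σ.cycleFactorsFinset, ∃ x, x ∈ (c : Equiv.Perm α).support := by
    rintro ⟨c, hc⟩
    have hcyc := (Equiv.Perm.mem_cycleFactorsFinset_iff.1 hc).1
    exact Finset.card_pos.1 (zero_lt_two.trans_le hcyc.two_le_card_support)
  choose r hr using hne
  have hcycle : ∀ c : σ.cycleFactorsFinset, (c : Equiv.Perm α) = σ.cycleOf (r c) := fun c =>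
    Equiv.Perm.cycle_is_cycleOf (hr c) c.2
  have hsame : ∀ c c' : σ.cycleFactorsFinset, σ.SameCycle (r c) (r c') → c = c' := fun c c' h =>
    Subtype.ext (by rw [hcycle c, hcycle c', h.cycleOf_eq])
  have hinj : Function.Injective r := fun c c' h =>
    hsame c c' (h ▸ Equiv.Perm.SameCycle.refl _ _)
  refine ⟨Finset.univ.image r, ?_, ?_⟩
  · rw [Finset.card_image_of_injective _ hinj, Finset.card_univ, Fintype.card_coe,
      Equiv.Perm.cycleType_def, Multiset.card_map]
    rfl
  · intro x hx y hy h
    obtain ⟨c, _, rfl⟩ := Finset.mem_image.1 hx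
    obtain ⟨c', _, rfl⟩ := Finset.mem_image.1 hy
    rw [hsame c c' h]

lemma Equiv.Perm.sum_pow_card_cycleType_le {α : Type*} [Fintype α] [DecidableEq α] :
    ∑ σ : Equiv.Perm α, (Fintype.card α) ^ σ.cycleType.card ≤
      (2 * Fintype.card α) ^ Fintype.card α := by
  choose S hcard hS using fun σ : Equiv.Perm α => σ.exists_transversal
  set F : Equiv.Perm α → α → Option α := fun σ x => if x ∈ S σ then none else some (σ x) with hF
  set w : Option α → ℕ := fun o => o.elim (Fintype.card α) fun _ => 1 with hw
  have hFinj : Function.Injective F := by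
    intro σ τ h
    have hmem : ∀ x, x ∈ S σ ↔ x ∈ S τ := by
      intro x
      have := congrFun h x
      simp only [hF] at this
      split_ifs at this <;> simp_all
    refine Equiv.Perm.eq_of_eqOn_compl (S := S σ) (hS σ) ?_ ?_
    · intro x hx y hy
      exact hS τ x ((hmem x).1 hx) y ((hmem y).1 hy)
    · intro x hx
      have hx' : x ∉ S τ := fun h => hx ((hmem x).2 h)
      have := congrFun h x
      have hx0 : x ∉ S σ := hx
      simpa [hF, hx0, hx'] using this
  have hweight : ∀ σ : Equiv.Perm α, ∏ x, w (F σ x) = Fintype.card α ^ σ.cycleType.card := by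
    intro σ
    have : ∀ x, w (F σ x) = if x ∈ S σ then Fintype.card α else 1 := by
      intro x; simp only [hF, hw]; split_ifs <;> rfl
    simp only [this]
    rw [Finset.prod_ite_mem, Finset.univ_inter, Finset.prod_const, hcard]
  calc ∑ σ : Equiv.Perm α, (Fintype.card α) ^ σ.cycleType.card
      = ∑ f ∈ Finset.univ.image F, ∏ x, w (f x) := by
        rw [Finset.sum_image fun _ _ _ _ h => hFinj h]
        exact Finset.sum_congr rfl fun σ _ => (hweight σ).symm
    _ ≤ ∑ f : α → Option α, ∏ x, w (f x) :=
        Finset.sum_le_sum_of_subset (Finset.subset_univ _)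
    _ = (2 * Fintype.card α) ^ Fintype.card α := by
        rw [← Fintype.piFinset_univ, ← Finset.prod_univ_sum]
        simp [hw, Fintype.sum_option, two_mul]

/-- let `B` be a `θn`-regular bipartite graph and `M₁` a perfect matching
edge-disjoint from `B`.  Identifying perfect matchings with bijections `U ≃ W`, the cycles
of the 2-factor `M₁ ∪ M₂` correspond to the cycles of the fixed-point-free permutation
`M₂⁻¹ ∘ M₁` of `U`.  Then the number of perfect matchings `M₂` of `B` for which
`M₁ ∪ M₂` has more than `n/(log n)^{1/5}` cycles is at most `e^{-n}` times the total
number of perfect matchings of `B`. -/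
theorem random_perfect_matching_union_has_few_cycles :
    ∀ θ : ℝ, 0 < θ → θ ≤ 1 →
    ∃ n₀ : ℕ, ∀ n : ℕ, n₀ ≤ n →
    ∀ (U W : Type) [Fintype U] [Fintype W] [DecidableEq U] [DecidableEq W],
      Fintype.card U = n → Fintype.card W = n →
    ∀ B : Finset (U × W),
      (∀ u : U, (degL B u : ℝ) = θ * (n : ℝ)) →
      (∀ w : W, (degR B w : ℝ) = θ * (n : ℝ)) →
    ∀ M₁ : U ≃ W, (∀ u, (u, M₁ u) ∉ B) →
      ((Nat.card {g : U ≃ W // (∀ u, (u, g u) ∈ B) ∧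
          (n : ℝ) / (Real.log (n : ℝ)) ^ ((1:ℝ)/5) <
            ((Equiv.Perm.cycleType (M₁.trans g.symm)).card : ℝ)}) : ℝ) ≤
        Real.exp (-(n : ℝ)) * ((Nat.card {g : U ≃ W // ∀ u, (u, g u) ∈ B}) : ℝ) := by
  intro θ hθ _
  have hlim : Filter.Tendsto (fun n : ℕ => Real.log (n : ℝ) ^ ((4 : ℝ) / 5)) Filter.atTop
      Filter.atTop :=
    (tendsto_rpow_atTop (by norm_num)).comp
      (Real.tendsto_log_atTop.comp tendsto_natCast_atTop_atTop)
  obtain ⟨n₁, hn₁⟩ := Filter.eventually_atTop.1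
    (hlim.eventually_ge_atTop (Real.log (8 * Real.exp 1 / θ)))
  refine ⟨max n₁ 2, fun n hn U W _ _ _ _ hU hW B hL hR M₁ _ => ?_⟩
  have hn2 : 2 ≤ n := (le_max_right _ _).trans hn
  have hn0 : (0 : ℝ) < n := by positivity
  have hlog : 0 < Real.log (n : ℝ) := Real.log_pos (by exact_mod_cast hn2)
  have hgap := hn₁ n ((le_max_left _ _).trans hn)
  have : Nonempty U := Fintype.card_pos_iff.1 (by omega)
  have hlow := pow_le_card_perfectMatching (hU.trans hW.symm) (mul_pos hθ hn0) B hL hR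
  rw [hU] at hlow
  set k : ℝ := (n : ℝ) / (Real.log (n : ℝ)) ^ ((1 : ℝ) / 5) with hk
  have hpow : (n : ℝ) ^ k = Real.exp (Real.log (n : ℝ) ^ ((4 : ℝ) / 5)) ^ n := by
    have : Real.log (n : ℝ) / Real.log (n : ℝ) ^ ((1 : ℝ) / 5) =
        Real.log (n : ℝ) ^ ((4 : ℝ) / 5) := by
      nth_rewrite 1 [← Real.rpow_one (Real.log (n : ℝ))]
      rw [← Real.rpow_sub hlog]
      norm_num
    rw [Real.rpow_def_of_pos hn0, ← Real.exp_nat_mul, hk, ← this]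
    congr 1
    ring
  set X := {g : U ≃ W // (∀ u, (u, g u) ∈ B) ∧
    k < ((Equiv.Perm.cycleType (M₁.trans g.symm)).card : ℝ)}
  have hup : (Nat.card X : ℝ) * (n : ℝ) ^ k ≤ (2 * n : ℝ) ^ n := by
    have hsum := Equiv.Perm.sum_pow_card_cycleType_le (α := U)
    rw [hU] at hsum
    have hinj : Function.Injective fun g : X => M₁.trans g.1.symm := by
      intro g g' h
      apply Subtype.ext
      have h' : ∀ w, g.1.symm w = g'.1.symm w := fun w => by
        simpa using Equiv.congr_fun h (M₁.symm w)
      have := congrArg Equiv.symm (Equiv.ext h')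
      simpa using this
    calc (Nat.card X : ℝ) * (n : ℝ) ^ k = ∑ _g : X, (n : ℝ) ^ k := by
          rw [Finset.sum_const, Finset.card_univ, Nat.card_eq_fintype_card, nsmul_eq_mul]
      _ ≤ ∑ g : X, (n : ℝ) ^ (Equiv.Perm.cycleType (M₁.trans g.1.symm)).card := by
          refine Finset.sum_le_sum fun g _ => ?_
          rw [← Real.rpow_natCast]
          exact Real.rpow_le_rpow_of_exponent_le (by exact_mod_cast (by omega : 1 ≤ n))
            g.2.2.le
      _ = ∑ σ ∈ Finset.univ.image fun g : X => M₁.trans g.1.symm,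
            (n : ℝ) ^ (Equiv.Perm.cycleType σ).card := by
          rw [Finset.sum_image fun _ _ _ _ h => hinj h]
      _ ≤ ∑ σ : Equiv.Perm U, (n : ℝ) ^ (Equiv.Perm.cycleType σ).card :=
          Finset.sum_le_sum_of_subset_of_nonneg (Finset.subset_univ _)
            fun _ _ _ => by positivity
      _ ≤ (2 * n : ℝ) ^ n := by exact_mod_cast hsum
  have hbase : 2 * n ≤ Real.exp (-1) * (θ * n / 4) *
      Real.exp (Real.log (n : ℝ) ^ ((4 : ℝ) / 5)) := by
    have h1 : 8 * Real.exp 1 / θ ≤ Real.exp (Real.log (n : ℝ) ^ ((4 : ℝ) / 5)) := by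
      rw [← Real.exp_log (by positivity : 0 < 8 * Real.exp 1 / θ)]
      exact Real.exp_le_exp.2 hgap
    calc 2 * (n : ℝ) = Real.exp (-1) * (θ * n / 4) * (8 * Real.exp 1 / θ) := by
          rw [Real.exp_neg]
          field_simp
          ring
      _ ≤ _ := mul_le_mul_of_nonneg_left h1 (by positivity)
  have hexp : Real.exp (-(n : ℝ)) = Real.exp (-1) ^ n := by
    rw [← Real.exp_nat_mul]
    congr 1
    ring
  have hkpos : (0 : ℝ) < (n : ℝ) ^ k := Real.rpow_pos_of_pos hn0 _
  refine le_trans ?_ (mul_le_mul_of_nonneg_left hlow (Real.exp_pos _).le)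
  rw [← mul_le_mul_iff_left₀ hkpos]
  refine hup.trans ((pow_le_pow_left₀ (by positivity) hbase n).trans_eq ?_)
  rw [hpow, hexp, mul_pow, mul_pow]
end
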